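/- arXiv:2408.16085 — 2 statements merged into one kernel-verified Lean document; each statement's English description precedes it below -/
import Mathlib

section
/- There exist a constant C ≥ 0 and a threshold N such that for every integer n ≥ N there exists a 2-planar finite simple graph of girth at least 5 on n vertices with at least (16/7)·n − C edges. -/
open unitInterval

/-- A (good) drawing of a simple graph in the plane: vertices map to distinct
points, each edge is drawn as a simple continuous arc between its endpoints,
arcs avoid vertex points other than their endpoints, two arcs meet in finitely
many points, and no three arcs pass through a common interior point. -/
structure PlaneDrawing {V : Type*} (G : SimpleGraph V) where
  pos : V → ℝ × ℝ
  pos_inj : Function.Injective pos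
  arc : ∀ ⦃u v : V⦄, G.Adj u v → Path (pos u) (pos v)
  arc_symm : ∀ ⦃u v : V⦄ (h : G.Adj u v), arc h.symm = (arc h).symm
  arc_inj : ∀ ⦃u v : V⦄ (h : G.Adj u v), Function.Injective (arc h)
  no_vertex_mem : ∀ ⦃u v : V⦄ (h : G.Adj u v) (w : V) (t : I),
      arc h t = pos w → w = u ∨ w = v
  finite_inter : ∀ ⦃u v x y : V⦄ (h₁ : G.Adj u v) (h₂ : G.Adj x y),
      s(u, v) ≠ s(x, y) →
      (Set.range (arc h₁) ∩ Set.range (arc h₂)).Finite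
  no_triple_point : ∀ ⦃u₁ v₁ u₂ v₂ u₃ v₃ : V⦄
      (h₁ : G.Adj u₁ v₁) (h₂ : G.Adj u₂ v₂) (h₃ : G.Adj u₃ v₃),
      s(u₁, v₁) ≠ s(u₂, v₂) → s(u₁, v₁) ≠ s(u₃, v₃) → s(u₂, v₂) ≠ s(u₃, v₃) →
      ∀ t₁ t₂ t₃ : I, t₁ ≠ 0 → t₁ ≠ 1 → t₂ ≠ 0 → t₂ ≠ 1 → t₃ ≠ 0 → t₃ ≠ 1 →
      arc h₁ t₁ = arc h₂ t₂ → arc h₂ t₂ = arc h₃ t₃ → False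

namespace PlaneDrawing

variable {V : Type*} {G : SimpleGraph V} (D : PlaneDrawing G)

/-- `p` is an interior point of the arc of the edge `uv`. -/
def IsInteriorPoint {u v : V} (h : G.Adj u v) (p : ℝ × ℝ) : Prop :=
  ∃ t : I, t ≠ 0 ∧ t ≠ 1 ∧ D.arc h t = p

/-- The set of crossing points of the drawing: points where the interiors of
the arcs of two distinct edges meet. -/
def crossings : Set (ℝ × ℝ) :=
  {p | ∃ (u v x y : V) (h₁ : G.Adj u v) (h₂ : G.Adj x y),
    s(u, v) ≠ s(x, y) ∧ D.IsInteriorPoint h₁ p ∧ D.IsInteriorPoint h₂ p}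

/-- The number of crossings of the drawing. -/
noncomputable def crossingCount : ℕ := D.crossings.ncard

/-- The set of crossing points lying on the edge `uv`. -/
def edgeCrossings {u v : V} (h : G.Adj u v) : Set (ℝ × ℝ) :=
  {p | D.IsInteriorPoint h p ∧
    ∃ (x y : V) (h₂ : G.Adj x y), s(u, v) ≠ s(x, y) ∧ D.IsInteriorPoint h₂ p}

/-- A drawing is `k`-plane if every edge is involved in at most `k` crossings. -/
def IsKPlane (k : ℕ) : Prop :=
  ∀ ⦃u v : V⦄ (h : G.Adj u v), (D.edgeCrossings h).ncard ≤ k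

end PlaneDrawing

/-- The crossing number of a graph: the minimum number of crossings over all
drawings. -/
noncomputable def crossingNumber {V : Type*} (G : SimpleGraph V) : ℕ :=
  sInf {c : ℕ | ∃ D : PlaneDrawing G, D.crossingCount = c}

/-- A graph is `k`-planar if it admits a drawing in which every edge is
involved in at most `k` crossings. -/
def KPlanar {V : Type*} (G : SimpleGraph V) (k : ℕ) : Prop :=
  ∃ D : PlaneDrawing G, D.IsKPlane k

/-- `G` has no cycle of length `ℓ`. -/
def HasNoCycleOfLength {V : Type*} (G : SimpleGraph V) (ℓ : ℕ) : Prop :=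
  ∀ (v : V) (c : G.Walk v v), c.IsCycle → c.length ≠ ℓ

namespace TwoPlanarGirthFive

/-- The three residue classes modulo `3` of the vertices of the periodic drawing. -/
def rep (t : ℕ) : ℤ × ℤ :=
  if t = 0 then (0, 0) else if t = 1 then (2, 2) else (2, 0)

/-- A point of the integer lattice that is a vertex of the periodic drawing. -/
def IsVertex (p : ℤ × ℤ) : Prop :=
  (p.1 % 3 = 0 ∧ p.2 % 3 = 0) ∨ (p.1 % 3 = 2 ∧ p.2 % 3 = 2) ∨ (p.1 % 3 = 2 ∧ p.2 % 3 = 0)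

/-- The residue class of the tail of an edge of each of the seven types. -/
def tail : Fin 7 → ℤ × ℤ := ![(0, 0), (0, 0), (0, 0), (2, 0), (2, 2), (2, 2), (0, 0)]

/-- The displacement vector of an edge of each of the seven types. -/
def disp : Fin 7 → ℤ × ℤ :=
  ![(-1, -1), (2, 3), (-1, -3), (-2, 0), (3, -2), (0, 1), (3, -3)]

/-- `p` is the tail of an edge of type `i`. -/
def IsTail (i : Fin 7) (p : ℤ × ℤ) : Prop :=
  p.1 % 3 = (tail i).1 ∧ p.2 % 3 = (tail i).2

/-- The type and relative position of the first edge crossing an edge of type `i`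
(a dummy value if there is none). -/
def firstCrossing : Fin 7 → Fin 7 × (ℤ × ℤ) :=
  ![(0, 0), (4, (-1, 2)), (4, (-1, -1)), (0, 0), (1, (1, -2)), (0, 0), (1, (0, -3))]

/-- The type and relative position of the second edge crossing an edge of type `i`
(a dummy value if there is none). -/
def secondCrossing : Fin 7 → Fin 7 × (ℤ × ℤ) :=
  ![(0, 0), (6, (0, 3)), (6, (-3, 0)), (0, 0), (2, (1, 1)), (0, 0), (2, (3, 0))]

/-- The parameter of the first crossing on an edge of type `i`. -/
noncomputable def firstParam : Fin 7 → ℝ := ![0, 4 / 13, 5 / 11, 0, 7 / 13, 0, 2 / 5]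

/-- The parameter of the second crossing on an edge of type `i`. -/
noncomputable def secondParam : Fin 7 → ℝ := ![1, 3 / 5, 3 / 4, 1, 2 / 11, 1, 3 / 4]

lemma disp_ne_zero : ∀ i, disp i ≠ 0 := by
  decide

/-- The periodic graph on the integer lattice. -/
def latticeGraph : SimpleGraph (ℤ × ℤ) where
  Adj u v := ∃ i p, IsTail i p ∧ ((u = p ∧ v = p + disp i) ∨ (v = p ∧ u = p + disp i))
  symm := ⟨by
    rintro u v ⟨i, p, hp, h⟩
    exact ⟨i, p, hp, h.symm⟩⟩
  loopless := ⟨by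
    rintro u ⟨i, p, -, h⟩
    refine disp_ne_zero i ?_
    rcases h with ⟨h₁, h₂⟩ | ⟨h₁, h₂⟩ <;> subst h₁ <;> simpa using h₂⟩

/-! ### Straight segments between lattice points -/

/-- The point with parameter `t` on the segment from `u` to `v`. -/
def seg (u v : ℤ × ℤ) (t : ℝ) : ℝ × ℝ :=
  (u.1 + t * (v.1 - u.1), u.2 + t * (v.2 - u.2))

lemma seg_zero (u v : ℤ × ℤ) : seg u v 0 = ((u.1 : ℝ), (u.2 : ℝ)) := by simp [seg]

lemma seg_one (u v : ℤ × ℤ) : seg u v 1 = ((v.1 : ℝ), (v.2 : ℝ)) := by simp [seg]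

lemma seg_symm (u v : ℤ × ℤ) (t : ℝ) : seg u v (1 - t) = seg v u t := by
  simp only [seg, Prod.mk.injEq]
  constructor <;> ring

lemma continuous_seg (u v : ℤ × ℤ) : Continuous (seg u v) := by
  unfold seg
  fun_prop

lemma seg_injective {u v : ℤ × ℤ} (h : u ≠ v) : Function.Injective (seg u v) := by
  intro s t hst
  simp only [seg, Prod.mk.injEq, add_right_inj, mul_eq_mul_right_iff, sub_eq_zero,
    Int.cast_inj] at hst
  by_contra hne
  exact h (Prod.ext (hst.1.resolve_left hne).symm (hst.2.resolve_left hne).symm)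

/-- The determinant of two lattice vectors. -/
def det (a b : ℤ × ℤ) : ℤ := a.1 * b.2 - a.2 * b.1

lemma seg_eq_iff {p q a b : ℤ × ℤ} {s t : ℝ} :
    seg p (p + a) s = seg q (q + b) t ↔
      (p.1 + s * a.1 : ℝ) = q.1 + t * b.1 ∧ (p.2 + s * a.2 : ℝ) = q.2 + t * b.2 := by
  simp [seg]

lemma param_mul_det {p q a b : ℤ × ℤ} {s t : ℝ} (h : seg p (p + a) s = seg q (q + b) t) :
    s * det a b = det (q - p) b ∧ t * det a b = det (q - p) a := by
  obtain ⟨h₁, h₂⟩ := seg_eq_iff.1 h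
  simp only [det, Prod.fst_sub, Prod.snd_sub]
  push_cast
  constructor
  · linear_combination (b.2 : ℝ) * h₁ - b.1 * h₂
  · linear_combination (a.2 : ℝ) * h₁ - a.1 * h₂

lemma strictly_between {s : ℝ} {d z : ℤ} (h₀ : 0 < s) (h₁ : s < 1) (h : s * d = z) :
    (0 < z ∧ z < d) ∨ (d < z ∧ z < 0) ∨ (d = 0 ∧ z = 0) := by
  rcases lt_trichotomy d 0 with hd | hd | hd
  · have hd' : (d : ℝ) < 0 := by exact_mod_cast hd
    right; left
    constructor
    · have : (d : ℝ) < z := by nlinarith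
      exact_mod_cast this
    · have : (z : ℝ) < 0 := by nlinarith
      exact_mod_cast this
  · right; right
    subst hd
    refine ⟨rfl, ?_⟩
    have : (z : ℝ) = 0 := by rw [← h]; simp
    exact_mod_cast this
  · have hd' : (0 : ℝ) < d := by exact_mod_cast hd
    left
    constructor
    · have : (0 : ℝ) < z := by nlinarith
      exact_mod_cast this
    · have : (z : ℝ) < d := by nlinarith
      exact_mod_cast this

lemma strictly_between_neg {s : ℝ} {d z : ℤ} (h₀ : -1 < s) (h₁ : s < 1) (h : s * d = z) :
    (-d < z ∧ z < d) ∨ (d < z ∧ z < -d) ∨ (d = 0 ∧ z = 0) := by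
  have := strictly_between (s := (s + 1) / 2) (d := 2 * d) (z := z + d) (by linarith)
    (by linarith) (by push_cast; linarith)
  omega

lemma weakly_between {s : ℝ} {d z : ℤ} (h₀ : 0 ≤ s) (h₁ : s ≤ 1) (h : s * d = z) :
    (0 ≤ z ∧ z ≤ d) ∨ (d ≤ z ∧ z ≤ 0) := by
  rcases h₀.eq_or_lt with rfl | h₀
  · have : (z : ℝ) = 0 := by rw [← h]; simp
    have : z = 0 := by exact_mod_cast this
    omega
  rcases h₁.eq_or_lt with rfl | h₁
  · have : z = d := by
      have : (z : ℝ) = d := by rw [← h]; simp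
      exact_mod_cast this
    omega
  have := strictly_between h₀ h₁ h
  omega

/-! ### Crossings in the periodic drawing -/

lemma eq_of_det_eq_zero : ∀ i j : Fin 7, det (disp i) (disp j) = 0 → i = j := by
  decide

lemma eq_of_parallel {i : Fin 7} {p q : ℤ × ℤ} (hp : IsTail i p) (hq : IsTail i q)
    {s t : ℝ} (hs₀ : 0 < s) (hs₁ : s < 1) (ht₀ : 0 < t) (ht₁ : t < 1)
    (h : seg p (p + disp i) s = seg q (q + disp i) t) : p = q := by
  obtain ⟨h₁, h₂⟩ := seg_eq_iff.1 h
  have k := (param_mul_det h).1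
  have k₀ : det (q - p) (disp i) = 0 := by
    have h0 : det (disp i) (disp i) = 0 := by simp only [det]; ring
    rw [h0] at k
    have : ((det (q - p) (disp i) : ℤ) : ℝ) = 0 := by rw [← k]; simp
    exact_mod_cast this
  have b₁ := strictly_between_neg (s := s - t) (d := (disp i).1) (z := q.1 - p.1)
    (by linarith) (by linarith) (by push_cast; linarith)
  have b₂ := strictly_between_neg (s := s - t) (d := (disp i).2) (z := q.2 - p.2)
    (by linarith) (by linarith) (by push_cast; linarith)
  clear h h₁ h₂ k
  obtain ⟨p₁, p₂⟩ := p
  obtain ⟨q₁, q₂⟩ := q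
  rw [Prod.mk.injEq]
  fin_cases i <;> simp [IsTail, tail, disp, det] at hp hq k₀ b₁ b₂ ⊢ <;> omega

lemma crossing_classification {i j : Fin 7} {p q : ℤ × ℤ} (hp : IsTail i p) (hq : IsTail j q)
    (hz : 0 < det (q - p) (disp j) ∧ det (q - p) (disp j) < det (disp i) (disp j) ∨
      det (disp i) (disp j) < det (q - p) (disp j) ∧ det (q - p) (disp j) < 0)
    (hw : 0 < det (q - p) (disp i) ∧ det (q - p) (disp i) < det (disp i) (disp j) ∨
      det (disp i) (disp j) < det (q - p) (disp i) ∧ det (q - p) (disp i) < 0) :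
    (j, q - p) = firstCrossing i ∨ (j, q - p) = secondCrossing i := by
  obtain ⟨p₁, p₂⟩ := p
  obtain ⟨q₁, q₂⟩ := q
  fin_cases i <;> fin_cases j <;>
    simp [IsTail, tail, disp, det, firstCrossing, secondCrossing] at hp hq hz hw ⊢ <;> omega

lemma param_of_crossing (i : Fin 7) {s : ℝ} {c : Fin 7 × (ℤ × ℤ)}
    (hs : 0 < s) (hd : det (disp i) (disp c.1) ≠ 0)
    (h : s * det (disp i) (disp c.1) = det c.2 (disp c.1)) :
    (c = firstCrossing i → s = firstParam i) ∧ (c = secondCrossing i → s = secondParam i) := by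
  constructor <;> rintro rfl <;>
    fin_cases i <;> simp [disp, det, firstCrossing, secondCrossing, firstParam, secondParam]
      at h hd ⊢ <;> linarith

lemma firstParam_ne_secondParam (i : Fin 7) : firstParam i ≠ secondParam i := by
  fin_cases i <;> simp [firstParam, secondParam] <;> norm_num

lemma eq_or_crossing {i j : Fin 7} {p q : ℤ × ℤ} (hp : IsTail i p) (hq : IsTail j q)
    {s t : ℝ} (hs₀ : 0 < s) (hs₁ : s < 1) (ht₀ : 0 < t) (ht₁ : t < 1)
    (h : seg p (p + disp i) s = seg q (q + disp j) t) :
    (p = q ∧ i = j) ∨ ((j, q - p) = firstCrossing i ∧ s = firstParam i) ∨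
      ((j, q - p) = secondCrossing i ∧ s = secondParam i) := by
  by_cases hd : det (disp i) (disp j) = 0
  · obtain rfl := eq_of_det_eq_zero i j hd
    exact Or.inl ⟨eq_of_parallel hp hq hs₀ hs₁ ht₀ ht₁ h, rfl⟩
  · right
    obtain ⟨k₁, k₂⟩ := param_mul_det h
    have b₁ := strictly_between hs₀ hs₁ k₁
    have b₂ := strictly_between ht₀ ht₁ k₂
    have := param_of_crossing i (c := (j, q - p)) hs₀ hd k₁
    rcases crossing_classification hp hq (by tauto) (by tauto) with h' | h'
    · exact Or.inl ⟨h', this.1 h'⟩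
    · exact Or.inr ⟨h', this.2 h'⟩

lemma exists_oriented {u v : ℤ × ℤ} (h : latticeGraph.Adj u v) :
    ∃ i p, IsTail i p ∧ s(u, v) = s(p, p + disp i) ∧ ∀ t : ℝ, 0 < t → t < 1 →
      ∃ t' : ℝ, 0 < t' ∧ t' < 1 ∧ seg u v t = seg p (p + disp i) t' := by
  obtain ⟨i, p, hp, ⟨rfl, rfl⟩ | ⟨rfl, rfl⟩⟩ := h
  · exact ⟨i, u, hp, rfl, fun t h₀ h₁ => ⟨t, h₀, h₁, rfl⟩⟩
  · exact ⟨i, v, hp, Sym2.eq_swap, fun t h₀ h₁ =>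
      ⟨1 - t, by linarith, by linarith, (seg_symm _ _ _).symm⟩⟩

/-- Every edge is crossed by at most two edges, in two distinct points. -/
lemma exists_two_crossings {u v : ℤ × ℤ} (h : latticeGraph.Adj u v) :
    ∃ (e₁ e₂ : Sym2 (ℤ × ℤ)) (X₁ X₂ : ℝ × ℝ), X₁ ≠ X₂ ∧
      ∀ x y : ℤ × ℤ, latticeGraph.Adj x y → s(u, v) ≠ s(x, y) →
        ∀ s t : ℝ, 0 < s → s < 1 → 0 < t → t < 1 → seg u v s = seg x y t →
          (s(x, y) = e₁ ∧ seg u v s = X₁) ∨ (s(x, y) = e₂ ∧ seg u v s = X₂) := by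
  obtain ⟨i, p, hp, huv, hseg⟩ := exists_oriented h
  have hne : p ≠ p + disp i := fun h' => disp_ne_zero i (by simpa using h')
  let e : Fin 7 × (ℤ × ℤ) → Sym2 (ℤ × ℤ) := fun c => s(p + c.2, p + c.2 + disp c.1)
  refine ⟨e (firstCrossing i), e (secondCrossing i), seg p (p + disp i) (firstParam i),
    seg p (p + disp i) (secondParam i),
    fun h' => firstParam_ne_secondParam i (seg_injective hne h'), ?_⟩
  intro x y hxy hdist s t hs₀ hs₁ ht₀ ht₁ hst
  obtain ⟨j, q, hq, hxy', hseg'⟩ := exists_oriented hxy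
  obtain ⟨s', hs₀', hs₁', hs⟩ := hseg s hs₀ hs₁
  obtain ⟨t', ht₀', ht₁', ht⟩ := hseg' t ht₀ ht₁
  have he : s(x, y) = e (j, q - p) := by simp [e, hxy']
  rcases eq_or_crossing hp hq hs₀' hs₁' ht₀' ht₁' (by rw [← hs, ← ht, hst]) with
    ⟨rfl, rfl⟩ | ⟨h₁, h₂⟩ | ⟨h₁, h₂⟩
  · exact absurd (huv.trans hxy'.symm) hdist
  · exact Or.inl ⟨by rw [he, h₁], by rw [hs, h₂]⟩
  · exact Or.inr ⟨by rw [he, h₁], by rw [hs, h₂]⟩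

lemma vertex_on_oriented {i : Fin 7} {p w : ℤ × ℤ} (hp : IsTail i p) (hw : IsVertex w)
    {t : ℝ} (h₀ : 0 ≤ t) (h₁ : t ≤ 1)
    (h : seg p (p + disp i) t = ((w.1 : ℝ), (w.2 : ℝ))) : w = p ∨ w = p + disp i := by
  rw [← seg_zero w (w + disp i)] at h
  have k := (param_mul_det h).1
  have k₀ : det (w - p) (disp i) = 0 := by
    have h0 : det (disp i) (disp i) = 0 := by simp only [det]; ring
    rw [h0] at k
    have : ((det (w - p) (disp i) : ℤ) : ℝ) = 0 := by rw [← k]; simp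
    exact_mod_cast this
  obtain ⟨e₁, e₂⟩ := seg_eq_iff.1 h
  have b₁ := weakly_between (d := (disp i).1) (z := w.1 - p.1) h₀ h₁
    (by push_cast; linarith)
  have b₂ := weakly_between (d := (disp i).2) (z := w.2 - p.2) h₀ h₁
    (by push_cast; linarith)
  clear h e₁ e₂ k
  obtain ⟨p₁, p₂⟩ := p
  obtain ⟨w₁, w₂⟩ := w
  fin_cases i <;> simp [IsTail, IsVertex, tail, disp, det] at hp hw k₀ b₁ b₂ ⊢ <;> omega

lemma vertex_on_segment {u v w : ℤ × ℤ} (h : latticeGraph.Adj u v) (hw : IsVertex w)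
    {t : ℝ} (h₀ : 0 ≤ t) (h₁ : t ≤ 1) (ht : seg u v t = ((w.1 : ℝ), (w.2 : ℝ))) :
    w = u ∨ w = v := by
  obtain ⟨i, p, hp, ⟨rfl, rfl⟩ | ⟨rfl, rfl⟩⟩ := h
  · exact vertex_on_oriented hp hw h₀ h₁ ht
  · refine (vertex_on_oriented (t := 1 - t) hp hw (by linarith) (by linarith) ?_).symm
    rw [seg_symm, ht]

/-! ### The straight-line drawing -/

lemma unitInterval_pos {t : I} (h : t ≠ 0) : (0 : ℝ) < t := unitInterval.pos_iff_ne_zero.2 h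

lemma unitInterval_lt_one {t : I} (h : t ≠ 1) : (t : ℝ) < 1 := unitInterval.lt_one_iff_ne_one.2 h

/-- The straight-line drawing of a graph induced by the periodic graph. -/
def drawing {V : Type*} (φ : V → ℤ × ℤ) (hφ : Function.Injective φ)
    (hv : ∀ v, IsVertex (φ v)) : PlaneDrawing (latticeGraph.comap φ) where
  pos v := (((φ v).1 : ℝ), ((φ v).2 : ℝ))
  pos_inj u v h := by
    simp only [Prod.mk.injEq, Int.cast_inj] at h
    exact hφ (Prod.ext h.1 h.2)
  arc u v _ :=
    { toFun := fun t => seg (φ u) (φ v) t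
      continuous_toFun := (continuous_seg _ _).comp continuous_subtype_val
      source' := by simp [seg_zero]
      target' := by simp [seg_one] }
  arc_symm u v h := by
    ext1
    funext t
    exact (seg_symm _ _ _).symm
  arc_inj u v h s t hst := Subtype.ext (seg_injective (latticeGraph.ne_of_adj h) hst)
  no_vertex_mem u v h w t ht :=
    (vertex_on_segment h (hv w) t.2.1 t.2.2 ht).imp (fun h => hφ h) (fun h => hφ h)
  finite_inter u v x y h₁ h₂ hne := by
    obtain ⟨_, _, X₁, X₂, -, hX⟩ := exists_two_crossings h₁
    refine ((Set.toFinite {X₁, X₂, seg (φ u) (φ v) 0, seg (φ u) (φ v) 1,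
      seg (φ x) (φ y) 0, seg (φ x) (φ y) 1})).subset ?_
    rintro _ ⟨⟨s, rfl⟩, ⟨t, hst⟩⟩
    have hst' : seg (φ x) (φ y) t = seg (φ u) (φ v) s := hst
    change seg (φ u) (φ v) s ∈ _
    by_cases hs₀ : s = 0
    · simp [hs₀]
    by_cases hs₁ : s = 1
    · simp [hs₁]
    by_cases ht₀ : t = 0
    · simp [← hst', ht₀]
    by_cases ht₁ : t = 1
    · simp [← hst', ht₁]
    rcases hX _ _ h₂ (fun h => hne (Sym2.map.injective hφ h)) s t (unitInterval_pos hs₀)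
      (unitInterval_lt_one hs₁) (unitInterval_pos ht₀) (unitInterval_lt_one ht₁)
      hst'.symm with h | h <;> simp [h.2]
  no_triple_point u₁ v₁ u₂ v₂ u₃ v₃ h₁ h₂ h₃ h₁₂ h₁₃ h₂₃ t₁ t₂ t₃ a₁ b₁ a₂ b₂ a₃ b₃ e₁₂ e₂₃ := by
    obtain ⟨c₁, c₂, X₁, X₂, hne, hX⟩ := exists_two_crossings h₁
    have h₂₃' : s(φ u₂, φ v₂) ≠ s(φ u₃, φ v₃) := fun h => h₂₃ (Sym2.map.injective hφ h)
    have k₂ := hX _ _ h₂ (fun h => h₁₂ (Sym2.map.injective hφ h)) t₁ t₂ (unitInterval_pos a₁)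
      (unitInterval_lt_one b₁) (unitInterval_pos a₂) (unitInterval_lt_one b₂) e₁₂
    have k₃ := hX _ _ h₃ (fun h => h₁₃ (Sym2.map.injective hφ h)) t₁ t₃ (unitInterval_pos a₁)
      (unitInterval_lt_one b₁) (unitInterval_pos a₃) (unitInterval_lt_one b₃) (e₁₂.trans e₂₃)
    rcases k₂ with ⟨k₂, l₂⟩ | ⟨k₂, l₂⟩ <;> rcases k₃ with ⟨k₃, l₃⟩ | ⟨k₃, l₃⟩
    · exact h₂₃' (k₂.trans k₃.symm)
    · exact hne (l₂.symm.trans l₃)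
    · exact hne (l₃.symm.trans l₂)
    · exact h₂₃' (k₂.trans k₃.symm)

lemma kPlanar_comap {V : Type*} (φ : V → ℤ × ℤ) (hφ : Function.Injective φ)
    (hv : ∀ v, IsVertex (φ v)) : KPlanar (latticeGraph.comap φ) 2 := by
  refine ⟨drawing φ hφ hv, fun u v h => ?_⟩
  obtain ⟨_, _, X₁, X₂, -, hX⟩ := exists_two_crossings h
  refine (Set.ncard_le_ncard (t := {X₁, X₂}) ?_ (Set.toFinite _)).trans ((Set.ncard_insert_le _ _).trans (by simp))
  rintro _ ⟨⟨s, hs₀, hs₁, rfl⟩, x, y, h₂, hne, t, ht₀, ht₁, hst⟩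
  rcases hX _ _ h₂ (fun h => hne (Sym2.map.injective hφ h)) s t (unitInterval_pos hs₀)
    (unitInterval_lt_one hs₁) (unitInterval_pos ht₀) (unitInterval_lt_one ht₁)
    hst.symm with h | h
  · exact Or.inl h.2
  · exact Or.inr h.2

/-! ### Short cycles -/

/-- The residue class of the tail of each dart of the periodic graph. -/
def dartTail : Fin 14 → ℤ × ℤ :=
  ![(0, 0), (0, 0), (0, 0), (2, 0), (2, 2), (2, 2), (0, 0),
    (2, 2), (2, 0), (2, 0), (0, 0), (2, 0), (2, 0), (0, 0)]

/-- The displacement vector of each dart of the periodic graph. -/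
def dartDisp : Fin 14 → ℤ × ℤ :=
  ![(-1, -1), (2, 3), (-1, -3), (-2, 0), (3, -2), (0, 1), (3, -3),
    (1, 1), (-2, -3), (1, 3), (2, 0), (-3, 2), (0, -1), (-3, 3)]

/-- The residue class of a lattice point modulo `3`. -/
def residue (p : ℤ × ℤ) : ℤ × ℤ := (p.1 % 3, p.2 % 3)

lemma residue_add (p q : ℤ × ℤ) : residue (p + q) = residue (residue p + q) := by
  simp [residue]

lemma exists_dart {u v : ℤ × ℤ} (h : latticeGraph.Adj u v) :
    ∃ d, residue u = dartTail d ∧ v = u + dartDisp d := by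
  obtain ⟨i, p, hp, ⟨rfl, rfl⟩ | ⟨rfl, rfl⟩⟩ := h
  · refine ⟨i.castLE (by norm_num), ?_⟩
    fin_cases i <;> simpa [residue, IsTail, tail, disp, dartTail, dartDisp] using hp
  · refine ⟨i.natAdd 7, ?_⟩
    obtain ⟨p₁, p₂⟩ := v
    fin_cases i <;> simp [residue, IsTail, tail, disp, dartTail, dartDisp] at hp ⊢ <;> omega

/-- The residue class of the head of a dart. -/
def dartHead (d : Fin 14) : ℤ × ℤ := residue (dartTail d + dartDisp d)

lemma no_closed_three_darts : ∀ d₁ d₂ : Fin 14, dartHead d₁ = dartTail d₂ →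
    ∀ d₃ : Fin 14, dartHead d₂ = dartTail d₃ → dartDisp d₁ + dartDisp d₂ + dartDisp d₃ ≠ 0 := by
  decide +kernel

lemma closed_four_darts : ∀ d₁ d₂ : Fin 14, dartHead d₁ = dartTail d₂ →
    ∀ d₃ : Fin 14, dartHead d₂ = dartTail d₃ → ∀ d₄ : Fin 14, dartHead d₃ = dartTail d₄ →
      dartDisp d₁ + dartDisp d₂ + dartDisp d₃ + dartDisp d₄ = 0 →
      dartDisp d₁ + dartDisp d₂ = 0 ∨ dartDisp d₂ + dartDisp d₃ = 0 := by
  decide +kernel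

lemma dartHead_eq {u : ℤ × ℤ} {d : Fin 14} (h : residue u = dartTail d) :
    residue (u + dartDisp d) = dartHead d := by
  rw [residue_add, h, dartHead]

lemma triangle_free {a b c : ℤ × ℤ} (h₁ : latticeGraph.Adj a b) (h₂ : latticeGraph.Adj b c)
    (h₃ : latticeGraph.Adj c a) : False := by
  obtain ⟨d₁, k₁, rfl⟩ := exists_dart h₁
  obtain ⟨d₂, k₂, rfl⟩ := exists_dart h₂
  obtain ⟨d₃, k₃, e⟩ := exists_dart h₃
  refine no_closed_three_darts d₁ d₂ ((dartHead_eq k₁).symm.trans k₂) d₃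
    ((dartHead_eq k₂).symm.trans k₃) ?_
  rw [add_assoc, add_assoc] at e
  rw [add_assoc]
  exact left_eq_add.1 e

lemma four_cycle_free {a b c d : ℤ × ℤ} (h₁ : latticeGraph.Adj a b)
    (h₂ : latticeGraph.Adj b c) (h₃ : latticeGraph.Adj c d) (h₄ : latticeGraph.Adj d a) :
    a = c ∨ b = d := by
  obtain ⟨d₁, k₁, rfl⟩ := exists_dart h₁
  obtain ⟨d₂, k₂, rfl⟩ := exists_dart h₂
  obtain ⟨d₃, k₃, rfl⟩ := exists_dart h₃
  obtain ⟨d₄, k₄, e⟩ := exists_dart h₄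
  refine (closed_four_darts d₁ d₂ ((dartHead_eq k₁).symm.trans k₂) d₃
    ((dartHead_eq k₂).symm.trans k₃) d₄ ((dartHead_eq k₃).symm.trans k₄) ?_).imp ?_ ?_
  · simp only [add_assoc] at e ⊢
    exact left_eq_add.1 e
  · intro h
    rw [add_assoc, h, add_zero]
  · intro h
    rw [add_assoc (a + _), h, add_zero]

lemma no_cycle_three {V : Type*} {φ : V → ℤ × ℤ} :
    HasNoCycleOfLength (latticeGraph.comap φ) 3 := by
  intro v c _ hl
  match c, hl with
  | .cons h₁ (.cons h₂ (.cons h₃ .nil)), _ => exact triangle_free h₁ h₂ h₃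

lemma no_cycle_four {V : Type*} {φ : V → ℤ × ℤ} (hφ : Function.Injective φ) :
    HasNoCycleOfLength (latticeGraph.comap φ) 4 := by
  intro v c hc hl
  match c, hc, hl with
  | .cons h₁ (.cons h₂ (.cons h₃ (.cons h₄ .nil))), hc, _ =>
    have hn := hc.support_nodup
    simp only [SimpleGraph.Walk.support_cons, SimpleGraph.Walk.support_nil, List.tail_cons,
      List.nodup_cons, List.mem_cons, not_or] at hn
    rcases four_cycle_free h₁ h₂ h₃ h₄ with h | h
    · exact hn.2.1.2.1 (hφ h).symm
    · exact hn.1.2.1 (hφ h)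

/-! ### Finite pieces of the periodic graph -/

/-- Enumeration of the vertices of the periodic drawing in a half-strip of `100` rows of cells. -/
def stripVertex (k : ℕ) : ℤ × ℤ :=
  (3 * ((k / 300 : ℕ) : ℤ) + (rep (k % 3)).1, 3 * ((k % 300 / 3 : ℕ) : ℤ) + (rep (k % 3)).2)

lemma rep_cases (k : ℕ) : (k % 3 = 0 ∧ rep (k % 3) = (0, 0)) ∨
    (k % 3 = 1 ∧ rep (k % 3) = (2, 2)) ∨ (k % 3 = 2 ∧ rep (k % 3) = (2, 0)) := by
  have : k % 3 = 0 ∨ k % 3 = 1 ∨ k % 3 = 2 := by omega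
  rcases this with h | h | h <;> simp [h, rep]

lemma stripVertex_injective : Function.Injective stripVertex := by
  intro k l h
  rw [stripVertex, stripVertex, Prod.mk.injEq] at h
  rcases rep_cases k with ⟨hk, ek⟩ | ⟨hk, ek⟩ | ⟨hk, ek⟩ <;>
    rcases rep_cases l with ⟨hl, el⟩ | ⟨hl, el⟩ | ⟨hl, el⟩ <;>
    simp only [ek, el] at h <;> omega

lemma isVertex_stripVertex (k : ℕ) : IsVertex (stripVertex k) := by
  simp only [IsVertex, stripVertex]
  rcases rep_cases k with ⟨hk, ek⟩ | ⟨hk, ek⟩ | ⟨hk, ek⟩ <;> simp only [ek] <;> omega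

lemma exists_stripVertex_eq {p : ℤ × ℤ} (hp : IsVertex p) {m : ℕ} (h₁ : 0 ≤ p.1)
    (h₂ : p.1 < 3 * m) (h₃ : 0 ≤ p.2) (h₄ : p.2 < 300) :
    ∃ k, k < 300 * m ∧ stripVertex k = p := by
  obtain ⟨x, y⟩ := p
  lift x to ℕ using h₁
  lift y to ℕ using h₃
  simp only [IsVertex] at hp h₂ h₄
  have key : ∀ t : ℕ, t < 3 → rep t = ((x : ℤ) % 3, (y : ℤ) % 3) →
      ∃ k, k < 300 * m ∧ stripVertex k = ((x : ℤ), (y : ℤ)) := by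
    intro t ht h
    refine ⟨300 * (x / 3) + 3 * (y / 3) + t, by omega, ?_⟩
    have : (300 * (x / 3) + 3 * (y / 3) + t) % 3 = t := by omega
    rw [stripVertex, this, h, Prod.mk.injEq]
    constructor <;> push_cast <;> omega
  rcases hp with h | h | h
  · exact key 0 (by norm_num) (by simp [rep, h.1, h.2])
  · exact key 1 (by norm_num) (by simp [rep, h.1, h.2])
  · exact key 2 (by norm_num) (by simp [rep, h.1, h.2])

lemma disp_injective : Function.Injective disp := by
  have : ∀ i j, disp i = disp j → i = j := by decide
  exact fun i j => this i j

lemma disp_add_disp_ne_zero : ∀ i j, disp i + disp j ≠ 0 := by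
  decide

lemma oriented_edge_injective {i j : Fin 7} {p q : ℤ × ℤ}
    (h : s(p, p + disp i) = s(q, q + disp j)) : p = q ∧ i = j := by
  rw [Sym2.eq_iff] at h
  rcases h with ⟨rfl, h⟩ | ⟨rfl, h⟩
  · exact ⟨rfl, disp_injective (add_left_cancel h)⟩
  · exfalso
    rw [add_assoc] at h
    exact disp_add_disp_ne_zero j i (by simpa using h)

/-- The tail of the edge of type `e.2` in the cell `e.1`, shifted away from the boundary. -/
def cellPoint (e : (ℕ × ℕ) × Fin 7) : ℤ × ℤ :=
  (3 * (e.1.1 + 1 : ℤ), 3 * (e.1.2 + 1 : ℤ)) + tail e.2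

lemma edge_count_lower_bound (m n : ℕ) (hmn : 300 * (m + 2) ≤ n) :
    686 * m ≤ (latticeGraph.comap fun k : Fin n => stripVertex k).edgeSet.ncard := by
  set φ : Fin n → ℤ × ℤ := fun k => stripVertex k
  have hφ : Function.Injective φ := fun a b h => Fin.ext (stripVertex_injective h)
  let S : Finset ((ℕ × ℕ) × Fin 7) := (Finset.range m ×ˢ Finset.range 98) ×ˢ Finset.univ
  let g : (ℕ × ℕ) × Fin 7 → Sym2 (ℤ × ℤ) := fun e => s(cellPoint e, cellPoint e + disp e.2)
  have hg : Function.Injective g := by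
    rintro ⟨⟨a, b⟩, i⟩ ⟨⟨c, d⟩, j⟩ h
    obtain ⟨h₁, h₂⟩ := oriented_edge_injective h
    obtain rfl : i = j := h₂
    simp only [cellPoint, add_left_inj, Prod.mk.injEq] at h₁
    obtain ⟨h₁, h₂⟩ := h₁
    simp only [Prod.mk.injEq, and_true]
    omega
  have hcard : S.card = 686 * m := by
    simp [S, Finset.card_product]
    ring
  have hS : g '' (S : Set _) ⊆ Sym2.map φ '' (latticeGraph.comap φ).edgeSet := by
    rintro _ ⟨⟨⟨a, b⟩, i⟩, he, rfl⟩
    simp only [S, Finset.coe_product, Set.mem_prod, Finset.coe_range, Set.mem_Iio] at he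
    obtain ⟨⟨ha, hb⟩, -⟩ := he
    have hadj : latticeGraph.Adj (cellPoint ((a, b), i)) (cellPoint ((a, b), i) + disp i) := by
      refine ⟨i, _, ?_, Or.inl ⟨rfl, rfl⟩⟩
      fin_cases i <;> simp [IsTail, cellPoint, tail]
    have hex : ∀ q, (q = cellPoint ((a, b), i) ∨ q = cellPoint ((a, b), i) + disp i) →
        ∃ k : Fin n, φ k = q := by
      intro q hq
      have hq' : IsVertex q ∧ 0 ≤ q.1 ∧ q.1 < 3 * ((m + 2 : ℕ) : ℤ) ∧ 0 ≤ q.2 ∧ q.2 < 300 := by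
        rcases hq with rfl | rfl <;> fin_cases i <;>
          simp [IsVertex, cellPoint, tail, disp] <;> omega
      obtain ⟨hv, h₁, h₂, h₃, h₄⟩ := hq'
      obtain ⟨k, hk, rfl⟩ := exists_stripVertex_eq hv h₁ h₂ h₃ h₄
      exact ⟨⟨k, by omega⟩, rfl⟩
    obtain ⟨k, hk⟩ := hex _ (Or.inl rfl)
    obtain ⟨l, hl⟩ := hex _ (Or.inr rfl)
    refine ⟨s(k, l), ?_, ?_⟩
    · rw [SimpleGraph.mem_edgeSet, SimpleGraph.comap_adj, hk, hl]
      exact hadj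
    · simp [g, hk, hl]
  calc 686 * m = (g '' (S : Set _)).ncard := by
        rw [Set.ncard_image_of_injective _ hg, Set.ncard_coe_finset, hcard]
    _ ≤ (Sym2.map φ '' (latticeGraph.comap φ).edgeSet).ncard :=
        Set.ncard_le_ncard hS (Set.toFinite _)
    _ = _ := Set.ncard_image_of_injective _ (Sym2.map.injective hφ)

end TwoPlanarGirthFive

theorem stmt_15 :
    ∃ (C : ℝ) (N : ℕ), 0 ≤ C ∧ ∀ n : ℕ, N ≤ n →
      ∃ G : SimpleGraph (Fin n), HasNoCycleOfLength G 3 ∧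
        HasNoCycleOfLength G 4 ∧ KPlanar G 2 ∧
        (16 / 7 : ℝ) * n - C ≤ G.edgeSet.ncard := by
  refine ⟨2058, 0, by norm_num, fun n _ => ?_⟩
  have hφ : Function.Injective fun k : Fin n => TwoPlanarGirthFive.stripVertex k :=
    fun a b h => Fin.ext (TwoPlanarGirthFive.stripVertex_injective h)
  refine ⟨TwoPlanarGirthFive.latticeGraph.comap fun k : Fin n =>
    TwoPlanarGirthFive.stripVertex k, TwoPlanarGirthFive.no_cycle_three,
    TwoPlanarGirthFive.no_cycle_four hφ, TwoPlanarGirthFive.kPlanar_comap _ hφ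
      fun k => TwoPlanarGirthFive.isVertex_stripVertex k, ?_⟩
  rcases lt_or_ge n 600 with hn | hn
  · have h₁ : (n : ℝ) ≤ 600 := by exact_mod_cast hn.le
    refine le_trans ?_ (Nat.cast_nonneg _)
    linarith
  · obtain ⟨m, h₁, h₂⟩ : ∃ m, 300 * (m + 2) ≤ n ∧ n ≤ 300 * (m + 3) :=
      ⟨n / 300 - 2, by omega, by omega⟩
    have h₃ := TwoPlanarGirthFive.edge_count_lower_bound m n h₁
    have h₂' : (n : ℝ) ≤ 300 * (m + 3) := by exact_mod_cast h₂
    refine le_trans ?_ (Nat.cast_le.2 h₃)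
    push_cast
    linarith [(Nat.cast_nonneg m : (0 : ℝ) ≤ m)]
end

section
/- There exist a constant C ≥ 0 and a threshold N such that for every integer n ≥ N there exists a 3-planar finite simple graph of girth at least 5 on n vertices with at least (5/2)·n − C edges. -/
open unitInterval

/-! The extremal graphs are finite pieces of one infinite spiral: the vertices are the images of two
integer points under the powers of a linear map `turn` whose square is `-2`, and the edges are
straight segments, five for each power. The graph has no short cycles since the five offsets form a
Sidon set. By self-similarity, only finitely many pairs of segments have to be compared. -/

namespace SpiralDrawing

/-- A linear map of the plane whose square is `-2`. -/
def turn (p : ℤ × ℤ) : ℤ × ℤ := (-2 * p.2, p.1)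

def cross (p q : ℤ × ℤ) : ℤ := p.1 * q.2 - p.2 * q.1

/-- The orientation determinant of a triple of points. -/
def orient (a b c : ℤ × ℤ) : ℤ := cross (b - a) (c - a)

/-- A quadratic form that is doubled by `turn`. -/
def sqNorm (p : ℤ × ℤ) : ℤ := p.1 ^ 2 + 2 * p.2 ^ 2

def seg (a b : ℤ × ℤ) (s : ℝ) : ℝ × ℝ :=
  (a.1 + s * (b.1 - a.1), a.2 + s * (b.2 - a.2))

def even (k : ℕ) : ℤ × ℤ := turn^[k] (-3, 1)

def odd (k : ℕ) : ℤ × ℤ := turn^[k] (0, 1)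

def site (v : ℕ) : ℤ × ℤ := if v % 2 = 0 then even (v / 2) else odd (v / 2)

def offset : Fin 5 → ℕ := ![0, 1, 5, 13, 16]

theorem site_even (k : ℕ) : site (2 * k) = even k := by
  simp [site]

theorem site_odd (k : ℕ) : site (2 * k + 1) = odd k := by
  have h : (2 * k + 1) / 2 = k := by omega
  simp [site, h, Nat.add_mod]

theorem iterate_turn_sub (k : ℕ) (p q : ℤ × ℤ) :
    turn^[k] (p - q) = turn^[k] p - turn^[k] q := by
  induction k with
  | zero => rfl
  | succ k ih =>
    simp only [Function.iterate_succ_apply', ih]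
    ext <;> simp [turn]; ring

theorem cross_iterate (k : ℕ) (p q : ℤ × ℤ) :
    cross (turn^[k] p) (turn^[k] q) = 2 ^ k * cross p q := by
  induction k with
  | zero => simp
  | succ k ih =>
    rw [Function.iterate_succ_apply', Function.iterate_succ_apply', pow_succ, mul_right_comm, ← ih]
    simp only [cross, turn]; ring

theorem orient_iterate (k : ℕ) (a b c : ℤ × ℤ) :
    orient (turn^[k] a) (turn^[k] b) (turn^[k] c) = 2 ^ k * orient a b c := by
  simp only [orient, ← iterate_turn_sub, cross_iterate]

theorem sqNorm_iterate (k : ℕ) (p : ℤ × ℤ) : sqNorm (turn^[k] p) = 2 ^ k * sqNorm p := by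
  induction k with
  | zero => simp
  | succ k ih =>
    rw [Function.iterate_succ_apply', pow_succ, mul_right_comm, ← ih]
    simp only [sqNorm, turn]; ring

theorem even_add (k r : ℕ) : even (k + r) = turn^[k] (even r) :=
  Function.iterate_add_apply ..

theorem odd_add (k r : ℕ) : odd (k + r) = turn^[k] (odd r) :=
  Function.iterate_add_apply ..

theorem seg_symm (a b : ℤ × ℤ) (s : ℝ) : seg b a (1 - s) = seg a b s := by
  ext <;> simp only [seg] <;> ring

theorem seg_injective {a b : ℤ × ℤ} (h : a ≠ b) : Function.Injective (seg a b) := by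
  intro s t hst
  simp only [seg, Prod.mk.injEq, add_right_inj, mul_eq_mul_right_iff, sub_eq_zero,
    Int.cast_inj] at hst
  rcases hst with ⟨h1 | h1, h2 | h2⟩
  any_goals assumption
  exact absurd (Prod.ext h1.symm h2.symm) h

/-- The orientations of the endpoints of two segments that meet, in terms of the parameters. -/
theorem orient_of_seg_eq {a b c d : ℤ × ℤ} {s u : ℝ} (h : seg a b s = seg c d u) :
    (orient a b c : ℝ) = -u * cross (b - a) (d - c) ∧
    (orient a b d : ℝ) = (1 - u) * cross (b - a) (d - c) ∧
    (orient c d a : ℝ) = s * cross (b - a) (d - c) ∧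
    (orient c d b : ℝ) = -(1 - s) * cross (b - a) (d - c) := by
  simp only [seg, Prod.mk.injEq] at h
  obtain ⟨h1, h2⟩ := h
  simp only [orient, cross, Prod.fst_sub, Prod.snd_sub]
  push_cast
  refine ⟨?_, ?_, ?_, ?_⟩
  · linear_combination ((b.2 : ℝ) - a.2) * h1 - ((b.1 : ℝ) - a.1) * h2
  · linear_combination ((b.2 : ℝ) - a.2) * h1 - ((b.1 : ℝ) - a.1) * h2
  · linear_combination -((d.2 : ℝ) - c.2) * h1 + ((d.1 : ℝ) - c.1) * h2
  · linear_combination -((d.2 : ℝ) - c.2) * h1 + ((d.1 : ℝ) - c.1) * h2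

theorem orient_right (a b : ℤ × ℤ) : orient a b b = 0 := by
  simp only [orient, cross]; ring

theorem orient_mul_nonpos {a b c d : ℤ × ℤ} {s u : ℝ} (hs : s ∈ Set.Icc (0 : ℝ) 1)
    (hu : u ∈ Set.Icc (0 : ℝ) 1) (h : seg a b s = seg c d u) :
    orient a b c * orient a b d ≤ 0 ∧ orient c d a * orient c d b ≤ 0 := by
  obtain ⟨h1, h2, h3, h4⟩ := orient_of_seg_eq h
  have hu' := mul_nonneg hu.1 (sub_nonneg.2 hu.2)
  have hs' := mul_nonneg hs.1 (sub_nonneg.2 hs.2)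
  have hd := sq_nonneg (cross (b - a) (d - c) : ℝ)
  constructor
  · have : ((orient a b c * orient a b d : ℤ) : ℝ) ≤ 0 := by
      push_cast; rw [h1, h2]; nlinarith [mul_nonneg hu' hd]
    exact_mod_cast this
  · have : ((orient c d a * orient c d b : ℤ) : ℝ) ≤ 0 := by
      push_cast; rw [h3, h4]; nlinarith [mul_nonneg hs' hd]
    exact_mod_cast this

theorem sqNorm_seg_le (a b : ℤ × ℤ) {s : ℝ} (hs : s ∈ Set.Icc (0 : ℝ) 1) {m : ℝ}
    (ha : sqNorm a ≤ m) (hb : sqNorm b ≤ m) :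
    (seg a b s).1 ^ 2 + 2 * (seg a b s).2 ^ 2 ≤ m := by
  have h : (1 - s) * sqNorm a + s * sqNorm b ≤ m := by
    nlinarith [mul_le_mul_of_nonneg_left ha (sub_nonneg.2 hs.2),
      mul_le_mul_of_nonneg_left hb hs.1]
  refine le_trans ?_ h
  have hs' := mul_nonneg hs.1 (sub_nonneg.2 hs.2)
  simp only [seg, sqNorm]
  push_cast
  nlinarith [mul_nonneg hs' (sq_nonneg ((b.1 : ℝ) - a.1)),
    mul_nonneg hs' (sq_nonneg ((b.2 : ℝ) - a.2))]

theorem two_mul_cross_sq_le (a b : ℤ × ℤ) (s : ℝ) :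
    2 * (cross a b : ℝ) ^ 2 ≤
      ((seg a b s).1 ^ 2 + 2 * (seg a b s).2 ^ 2) * sqNorm (b - a) := by
  simp only [seg, sqNorm, cross, Prod.fst_sub, Prod.snd_sub]
  push_cast
  nlinarith [sq_nonneg ((a.1 + s * (b.1 - a.1) : ℝ) * (b.1 - a.1) +
    2 * (a.2 + s * (b.2 - a.2)) * (b.2 - a.2))]

theorem seg_eq_unique {a b c d : ℤ × ℤ} (hd : cross (b - a) (d - c) ≠ 0) {s u s' u' : ℝ}
    (h : seg a b s = seg c d u) (h' : seg a b s' = seg c d u') : s = s' := by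
  have hd' : (cross (b - a) (d - c) : ℝ) ≠ 0 := by exact_mod_cast hd
  exact mul_right_cancel₀ hd'
    ((orient_of_seg_eq h).2.2.1.symm.trans (orient_of_seg_eq h').2.2.1)

/-- The edge with index `(k, i)`. -/
def arcPt (e : ℕ × Fin 5) : ℝ → ℝ × ℝ := seg (even e.1) (odd (e.1 + offset e.2))

/-- The relative positions of the pairs of crossing edges. -/
def crossingTypes : Finset (ℕ × Fin 5 × Fin 5) :=
  {(4, 3, 1), (4, 3, 2), (4, 4, 0), (8, 3, 1), (8, 4, 0), (12, 4, 0)}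

/-- As `crossingTypes`, for ordered pairs. -/
def crossingShifts : Finset (ℤ × Fin 5 × Fin 5) :=
  crossingTypes.image (fun x => ((x.1 : ℤ), x.2.1, x.2.2)) ∪
    crossingTypes.image (fun x => (-(x.1 : ℤ), x.2.2, x.2.1))

/-- The segments `ab` and `cd` are disjoint, or they are not parallel and either `P` holds, or `Q`
holds and no endpoint of one lies on the line through the other. -/
abbrev PairCheck (a b c d : ℤ × ℤ) (P Q : Prop) : Prop :=
  0 < orient a b c * orient a b d ∨ 0 < orient c d a * orient c d b ∨
    cross (b - a) (d - c) ≠ 0 ∧ (P ∨ Q ∧ orient a b c ≠ 0 ∧ orient a b d ≠ 0 ∧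
      orient c d a ≠ 0 ∧ orient c d b ≠ 0)

set_option synthInstance.maxSize 1000 in
theorem near_pairs : ∀ r < 17, ∀ i j : Fin 5, (r = 0 → i ≠ j) →
    PairCheck (even 0) (odd (offset i)) (even r) (odd (r + offset j))
      (r = 0 ∨ offset i = r + offset j) ((r, i, j) ∈ crossingTypes) := by
  decide +kernel

theorem sqNorm_bounds : ∀ i : Fin 5, sqNorm (even 0) ≤ 2 ^ 17 ∧
    sqNorm (odd (offset i)) ≤ 2 ^ 17 ∧ 0 < sqNorm (odd (offset i) - even 0) ∧
    2 * sqNorm (odd (offset i) - even 0) ≤ 2 * cross (even 0) (odd (offset i)) ^ 2 := by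
  decide +kernel

theorem sqNorm_arcPt_le (e : ℕ × Fin 5) {s : ℝ} (hs : s ∈ Set.Icc (0 : ℝ) 1) :
    (arcPt e s).1 ^ 2 + 2 * (arcPt e s).2 ^ 2 ≤ 2 ^ e.1 * 2 ^ 17 := by
  obtain ⟨h1, h2, -, -⟩ := sqNorm_bounds e.2
  have h1' : sqNorm (even e.1) ≤ 2 ^ e.1 * 2 ^ 17 := by
    have := even_add e.1 0
    rw [add_zero] at this
    rw [this, sqNorm_iterate]; gcongr
  have h2' : sqNorm (odd (e.1 + offset e.2)) ≤ 2 ^ e.1 * 2 ^ 17 := by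
    rw [odd_add, sqNorm_iterate]; gcongr
  exact sqNorm_seg_le _ _ hs (by exact_mod_cast h1') (by exact_mod_cast h2')

theorem le_sqNorm_arcPt (e : ℕ × Fin 5) (s : ℝ) :
    2 ^ e.1 * 2 ≤ (arcPt e s).1 ^ 2 + 2 * (arcPt e s).2 ^ 2 := by
  obtain ⟨-, -, h3, h4⟩ := sqNorm_bounds e.2
  have h := two_mul_cross_sq_le (even e.1) (odd (e.1 + offset e.2)) s
  have h0 := even_add e.1 0
  rw [add_zero] at h0
  have hc : cross (even e.1) (odd (e.1 + offset e.2)) =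
      2 ^ e.1 * cross (even 0) (odd (offset e.2)) := by
    rw [h0, odd_add, cross_iterate]
  have hn : sqNorm (odd (e.1 + offset e.2) - even e.1) =
      2 ^ e.1 * sqNorm (odd (offset e.2) - even 0) := by
    rw [h0, odd_add, ← iterate_turn_sub, sqNorm_iterate]
  rw [hc, hn] at h
  push_cast at h
  change _ ≤ ((arcPt e s).1 ^ 2 + 2 * (arcPt e s).2 ^ 2) * _ at h
  set Q := (arcPt e s).1 ^ 2 + 2 * (arcPt e s).2 ^ 2
  have h3' : (0 : ℝ) < sqNorm (odd (offset e.2) - even 0) := by exact_mod_cast h3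
  have h4' : (2 : ℝ) * sqNorm (odd (offset e.2) - even 0) ≤
      2 * (cross (even 0) (odd (offset e.2)) : ℝ) ^ 2 := by exact_mod_cast h4
  have hp : (0 : ℝ) < 2 ^ e.1 := by positivity
  refine le_of_mul_le_mul_right ?_ (mul_pos hp h3')
  refine le_trans ?_ h
  nlinarith [mul_le_mul_of_nonneg_left h4' (mul_pos hp hp).le]

/-- Two edges meet at most once: at a common endpoint, or in a crossing of a listed type. -/
theorem meet_of_le {e f : ℕ × Fin 5} (hef : e ≠ f) (hle : e.1 ≤ f.1) {s u : ℝ}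
    (hs : s ∈ Set.Icc (0 : ℝ) 1) (hu : u ∈ Set.Icc (0 : ℝ) 1) (h : arcPt e s = arcPt f u) :
    cross (odd (e.1 + offset e.2) - even e.1) (odd (f.1 + offset f.2) - even f.1) ≠ 0 ∧
    (e.1 = f.1 ∧ s = 0 ∧ u = 0 ∨ e.1 + offset e.2 = f.1 + offset f.2 ∧ s = 1 ∧ u = 1 ∨
      (f.1 - e.1, e.2, f.2) ∈ crossingTypes ∧ s ≠ 0 ∧ s ≠ 1 ∧ u ≠ 0 ∧ u ≠ 1) := by
  obtain ⟨k, i⟩ := e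
  obtain ⟨l, j⟩ := f
  obtain ⟨r, rfl⟩ := Nat.exists_eq_add_of_le hle
  simp only [Nat.add_sub_cancel_left]
  have hr : r < 17 := by
    by_contra! hr
    have h1 := sqNorm_arcPt_le (k, i) hs
    have h2 := le_sqNorm_arcPt (k + r, j) u
    rw [← h] at h2
    have h3 : (2 : ℝ) ^ 17 ≤ 2 ^ r := pow_le_pow_right₀ (by norm_num) hr
    have h4 : (0 : ℝ) < 2 ^ k := by positivity
    simp only [pow_add] at h2
    nlinarith [mul_le_mul_of_nonneg_left h3 h4.le]
  have hk := even_add k 0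
  rw [add_zero] at hk
  have hij : r = 0 → i ≠ j := by rintro rfl rfl; exact hef rfl
  obtain ⟨n1, n2⟩ := orient_mul_nonpos hs hu h
  obtain ⟨o1, o2, o3, o4⟩ := orient_of_seg_eq h
  have hp : (0 : ℤ) < 2 ^ k := by positivity
  have key := near_pairs r hr i j hij
  unfold PairCheck at key
  simp only [hk, even_add k r, odd_add, add_assoc, orient_iterate, cross_iterate,
    ← iterate_turn_sub] at n1 n2 o1 o2 o3 o4 key ⊢
  rw [mul_mul_mul_comm] at n1 n2
  have hpp := mul_pos hp hp
  rcases key with key | key | ⟨hd, key⟩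
  · exact absurd n1 (not_le.2 (mul_pos hpp key))
  · exact absurd n2 (not_le.2 (mul_pos hpp key))
  have hpr : (2 : ℝ) ^ k ≠ 0 := by positivity
  refine ⟨mul_ne_zero hp.ne' hd, ?_⟩
  have hdr : (cross (odd (offset i) - even 0) (turn^[r] (odd (offset j)) - even r) : ℝ) ≠ 0 := by
    exact_mod_cast hd
  push_cast at o1 o2 o3 o4
  rcases key with (rfl | key) | ⟨hm, q1, q2, q3, q4⟩
  · left
    simp_all [orient, cross]
  · right; left
    have hh : odd (offset i) = turn^[r] (odd (offset j)) := by rw [key, odd_add]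
    rw [← hh] at o2 o4 hdr
    rw [orient_right] at o2 o4
    have hD := mul_ne_zero hpr hdr
    simp only [Int.cast_zero, mul_zero, zero_eq_mul, hD, neg_eq_zero, or_false,
      sub_eq_zero] at o2 o4
    exact ⟨by rw [key], o4.symm, o2.symm⟩
  · right; right
    refine ⟨hm, ?_, ?_, ?_, ?_⟩ <;> rintro rfl <;> simp_all

theorem meet {e f : ℕ × Fin 5} (hef : e ≠ f) {s u : ℝ}
    (hs : s ∈ Set.Icc (0 : ℝ) 1) (hu : u ∈ Set.Icc (0 : ℝ) 1) (h : arcPt e s = arcPt f u) :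
    e.1 = f.1 ∧ s = 0 ∧ u = 0 ∨ e.1 + offset e.2 = f.1 + offset f.2 ∧ s = 1 ∧ u = 1 ∨
      ((f.1 : ℤ) - e.1, e.2, f.2) ∈ crossingShifts ∧ s ≠ 0 ∧ s ≠ 1 ∧ u ≠ 0 ∧ u ≠ 1 := by
  simp only [crossingShifts, Finset.mem_union, Finset.mem_image]
  rcases le_total e.1 f.1 with hle | hle
  · rcases (meet_of_le hef hle hs hu h).2 with h' | h' | ⟨h1, h2⟩
    · exact .inl h'
    · exact .inr (.inl h')
    · refine .inr (.inr ⟨.inl ⟨_, h1, ?_⟩, h2⟩)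
      simp [Nat.cast_sub hle]
  · rcases (meet_of_le hef.symm hle hu hs h.symm).2 with h' | h' | ⟨h1, h2⟩
    · exact .inl (by tauto)
    · exact .inr (.inl (by tauto))
    · refine .inr (.inr ⟨.inr ⟨_, h1, ?_⟩, by tauto⟩)
      simp [Nat.cast_sub hle]

theorem meet_unique {e f : ℕ × Fin 5} (hef : e ≠ f) {s u s' u' : ℝ}
    (hs : s ∈ Set.Icc (0 : ℝ) 1) (hu : u ∈ Set.Icc (0 : ℝ) 1)
    (h : arcPt e s = arcPt f u) (h' : arcPt e s' = arcPt f u') : arcPt e s = arcPt e s' := by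
  rcases le_total e.1 f.1 with hle | hle
  · exact congrArg _ (seg_eq_unique (meet_of_le hef hle hs hu h).1 h h')
  · rw [h, h']
    exact congrArg _
      (seg_eq_unique (meet_of_le hef.symm hle hu hs h.symm).1 h.symm h'.symm)

theorem site_two_mul_ne (k : ℕ) : site (2 * k) ≠ site (2 * k + 1) := by
  intro h
  have h' := congrArg sqNorm h
  rw [site_even, site_odd, even, odd, sqNorm_iterate, sqNorm_iterate] at h'
  have hp : (2 : ℤ) ^ k ≠ 0 := by positivity
  exact absurd (mul_left_cancel₀ hp h') (by decide)

/-- The endpoints of the edge with index `e`. -/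
def ends (e : ℕ × Fin 5) : Sym2 ℕ := s(2 * e.1, 2 * (e.1 + offset e.2) + 1)

def pos (v : ℕ) : ℝ × ℝ := ((site v).1, (site v).2)

theorem exists_arcPt_eq_pos (w : ℕ) : arcPt (w / 2, 0) (w % 2 : ℕ) = pos w := by
  rcases Nat.even_or_odd' w with ⟨k, rfl | rfl⟩
  · simp [arcPt, seg, pos, site_even]
  · have h : (2 * k + 1) / 2 = k := by omega
    simp [arcPt, seg, pos, site_odd, h, offset, Nat.add_mod]

theorem mem_ends_of_pos_eq {e : ℕ × Fin 5} {w : ℕ} {s : ℝ} (hs : s ∈ Set.Icc (0 : ℝ) 1)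
    (h : arcPt e s = pos w) : w ∈ ends e := by
  rw [ends, Sym2.mem_iff]
  by_cases hef : e = (w / 2, 0)
  · subst hef
    simp only [offset, Matrix.cons_val_zero]
    omega
  rw [← exists_arcPt_eq_pos] at h
  have hw : w % 2 = 0 ∨ w % 2 = 1 := by omega
  have hu : ((w % 2 : ℕ) : ℝ) ∈ Set.Icc (0 : ℝ) 1 := by
    rcases hw with hw | hw <;> simp [hw]
  rcases meet hef hs hu h with ⟨h1, -, h2⟩ | ⟨h1, -, h2⟩ | ⟨-, -, -, h2, h3⟩
  · have h2' : w % 2 = 0 := by exact_mod_cast h2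
    simp only at h1
    omega
  · have h2' : w % 2 = 1 := by exact_mod_cast h2
    simp only [offset, Matrix.cons_val_zero] at h1 ⊢
    omega
  · rcases hw with hw | hw <;> simp [hw] at h2 h3

theorem pos_injective : Function.Injective pos := by
  intro v w h
  have hv := exists_arcPt_eq_pos v
  have hu : ((v % 2 : ℕ) : ℝ) ∈ Set.Icc (0 : ℝ) 1 := by
    rcases Nat.mod_two_eq_zero_or_one v with hw | hw <;> simp [hw]
  have hw := mem_ends_of_pos_eq hu (hv.trans h)
  have hs : site v = site w := by
    simp only [pos, Prod.mk.injEq, Int.cast_inj] at h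
    exact Prod.ext h.1 h.2
  have hne := site_two_mul_ne (v / 2)
  simp only [ends, offset, Matrix.cons_val_zero, add_zero, Sym2.mem_iff] at hw
  by_contra hvw
  rcases hw with hw | hw
  · have hv' : v = 2 * (v / 2) + 1 := by omega
    rw [← hv', ← hw] at hne
    exact hne hs.symm
  · have hv' : v = 2 * (v / 2) := by omega
    rw [← hw, ← hv'] at hne
    exact hne hs

/-- The graph whose edges are the segments with both endpoints among the first `n` sites. -/
def graph (n : ℕ) : SimpleGraph (Fin n) where
  Adj u v := ∃ e, s(u.val, v.val) = ends e
  symm := ⟨fun u v ⟨e, he⟩ => ⟨e, Sym2.eq_swap.trans he⟩⟩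
  loopless := ⟨fun u ⟨e, he⟩ => by
    simp only [ends, Sym2.eq_iff] at he
    omega⟩

/-- The straight segment between two sites. -/
def straight (u v : ℕ) : Path (pos u) (pos v) where
  toFun t := seg (site u) (site v) t
  continuous_toFun := by unfold seg; fun_prop
  source' := by simp [seg, pos]
  target' := by simp [seg, pos]

theorem straight_apply (u v : ℕ) (t : I) : straight u v t = seg (site u) (site v) t := rfl

theorem straight_eq_arcPt {u v : ℕ} {e : ℕ × Fin 5} (h : s(u, v) = ends e) (t : I) :
    ∃ s ∈ Set.Icc (0 : ℝ) 1, arcPt e s = straight u v t ∧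
      (t ≠ 0 → t ≠ 1 → s ≠ 0 ∧ s ≠ 1) := by
  have h0 : t ≠ 0 → (t : ℝ) ≠ 0 := fun h h' => h (Subtype.ext h')
  have h1 : t ≠ 1 → (t : ℝ) ≠ 1 := fun h h' => h (Subtype.ext h')
  rcases Sym2.eq_iff.1 h with ⟨rfl, rfl⟩ | ⟨rfl, rfl⟩
  · refine ⟨t, t.2, ?_, fun a b => ⟨h0 a, h1 b⟩⟩
    rw [straight_apply, site_even, site_odd, arcPt]
  · refine ⟨1 - t, ⟨by linarith [t.2.2], by linarith [t.2.1]⟩, ?_, fun a b =>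
      ⟨sub_ne_zero.2 (h1 b).symm, fun h => h0 a (by linarith)⟩⟩
    rw [straight_apply, site_even, site_odd, arcPt, seg_symm]

theorem no_crossing_triangle : ∀ a ∈ crossingShifts, ∀ b ∈ crossingShifts,
    a.2.2 = b.2.1 → (a.1 + b.1, a.2.1, b.2.2) ∉ crossingShifts := by
  decide +kernel

theorem card_crossingShifts : ∀ i : Fin 5,
    ((crossingShifts.filter (·.2.1 = i)).image fun x => (x.1, x.2.2)).card ≤ 3 := by
  decide +kernel

theorem ends_ne_of_ne {n : ℕ} {u v x y : Fin n} {e f : ℕ × Fin 5}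
    (he : s(u.val, v.val) = ends e) (hf : s(x.val, y.val) = ends f) (h : s(u, v) ≠ s(x, y)) :
    e ≠ f := by
  rintro rfl
  refine h (Sym2.map.injective Fin.val_injective ?_)
  simpa using he.trans hf.symm

/-- The type of a crossing of two edges at an interior point. -/
theorem crossing_mem {n : ℕ} {u v x y : Fin n} {e f : ℕ × Fin 5}
    (he : s(u.val, v.val) = ends e) (hf : s(x.val, y.val) = ends f) (h : s(u, v) ≠ s(x, y))
    {t t' : I} (h0 : t ≠ 0) (h1 : t ≠ 1) (htt' : straight u v t = straight x y t') :
    ((f.1 : ℤ) - e.1, e.2, f.2) ∈ crossingShifts := by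
  obtain ⟨s, hs, hp, hs'⟩ := straight_eq_arcPt he t
  obtain ⟨s', ht, hq, -⟩ := straight_eq_arcPt hf t'
  rcases meet (ends_ne_of_ne he hf h) hs ht (by rw [hp, hq, htt']) with h' | h' | h'
  · exact absurd h'.2.1 (hs' h0 h1).1
  · exact absurd h'.2.1 (hs' h0 h1).2
  · exact h'.1

theorem crossing_unique {n : ℕ} {u v : Fin n} {x y x' y' : Fin n} {e f : ℕ × Fin 5}
    (he : s(u.val, v.val) = ends e) (hf : s(x.val, y.val) = ends f)
    (hf' : s(x'.val, y'.val) = ends f) (h : s(u, v) ≠ s(x, y))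
    {t t' r r' : I} (h1 : straight u v t = straight x y r)
    (h2 : straight u v t' = straight x' y' r') : straight u v t = straight u v t' := by
  obtain ⟨s1, hs1, hp1, -⟩ := straight_eq_arcPt he t
  obtain ⟨s2, hs2, hp2, -⟩ := straight_eq_arcPt he t'
  obtain ⟨s3, hs3, hp3, -⟩ := straight_eq_arcPt hf r
  obtain ⟨s4, hs4, hp4, -⟩ := straight_eq_arcPt hf' r'
  rw [← hp1, ← hp2]
  exact meet_unique (ends_ne_of_ne he hf h) hs1 hs3 (by rw [hp1, hp3, h1])
    (by rw [hp2, hp4, h2])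

def drawing (n : ℕ) : PlaneDrawing (graph n) where
  pos v := pos v
  pos_inj := pos_injective.comp Fin.val_injective
  arc u v _ := straight u v
  arc_symm u v _ := by
    refine Path.ext (funext fun t => ?_)
    rw [Path.symm_apply, Function.comp_apply, straight_apply, straight_apply, ← seg_symm,
      unitInterval.coe_symm_eq]
  arc_inj u v h := by
    refine (seg_injective fun h' => h.ne (Fin.val_injective (pos_injective ?_))).comp
      Subtype.val_injective
    simp only [pos, h']
  no_vertex_mem u v h w t hw := by
    obtain ⟨e, he⟩ := h
    obtain ⟨s, hs, hp, -⟩ := straight_eq_arcPt he t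
    have := mem_ends_of_pos_eq hs (hp.trans hw)
    rw [← he, Sym2.mem_iff] at this
    exact this.imp Fin.ext Fin.ext
  finite_inter u v x y h₁ h₂ hne := by
    obtain ⟨e, he⟩ := h₁
    obtain ⟨f, hf⟩ := h₂
    refine Set.Subsingleton.finite ?_
    rintro _ ⟨⟨t, rfl⟩, ⟨r, hr⟩⟩ _ ⟨⟨t', rfl⟩, ⟨r', hr'⟩⟩
    exact crossing_unique he hf hf hne hr.symm hr'.symm
  no_triple_point u₁ v₁ u₂ v₂ u₃ v₃ h₁ h₂ h₃ h12 h13 h23 t₁ t₂ t₃ a1 b1 a2 b2 _ _ e12 e23 := by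
    obtain ⟨e, he⟩ := h₁
    obtain ⟨f, hf⟩ := h₂
    obtain ⟨g, hg⟩ := h₃
    refine no_crossing_triangle _ (crossing_mem he hf h12 a1 b1 e12) _
      (crossing_mem hf hg h23 a2 b2 e23) rfl ?_
    have := crossing_mem he hg h13 a1 b1 (e12.trans e23)
    simpa using this

theorem drawing_isKPlane (n : ℕ) : (drawing n).IsKPlane 3 := by
  rintro u v ⟨e, he⟩
  have key : ∀ p ∈ (drawing n).edgeCrossings ⟨e, he⟩, ∃ f : ℕ × Fin 5, ∃ x y : Fin n,
      s(x.val, y.val) = ends f ∧ s(u, v) ≠ s(x, y) ∧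
      ((f.1 : ℤ) - e.1, e.2, f.2) ∈ crossingShifts ∧
      ∃ t r : I, straight u v t = p ∧ straight x y r = p := by
    rintro p ⟨⟨t, h0, h1, rfl⟩, x, y, ⟨f, hf⟩, hne, ⟨r, -, -, hr⟩⟩
    exact ⟨f, x, y, hf, hne, crossing_mem he hf hne h0 h1 hr.symm, t, r, rfl, hr⟩
  choose! f x y hf hne hmem t r ht hr using key
  refine le_trans ?_ (card_crossingShifts e.2)
  rw [← Set.ncard_coe_finset]
  refine Set.ncard_le_ncard_of_injOn (fun p => (((f p).1 : ℤ) - e.1, (f p).2)) ?_ ?_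
    (Finset.finite_toSet _)
  · intro p hp
    simp only [Finset.coe_image, Set.mem_image, Finset.mem_coe, Finset.mem_filter]
    exact ⟨_, ⟨hmem p hp, rfl⟩, rfl⟩
  · intro p hp q hq hpq
    simp only [Prod.mk.injEq, sub_left_inj, Nat.cast_inj] at hpq
    have hfq := hf q hq
    rw [← Prod.ext hpq.1 hpq.2] at hfq
    have := crossing_unique he (hf p hp) hfq (hne p hp)
      ((ht p hp).trans (hr p hp).symm) ((ht q hq).trans (hr q hq).symm)
    rwa [ht p hp, ht q hq] at this

theorem adj_parity {n : ℕ} {u v : Fin n} (h : (graph n).Adj u v) :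
    u.val % 2 = 0 ∧ (∃ i, v.val = u.val + 2 * offset i + 1) ∨
      v.val % 2 = 0 ∧ ∃ i, u.val = v.val + 2 * offset i + 1 := by
  obtain ⟨e, he⟩ := h
  rcases Sym2.eq_iff.1 he with ⟨h1, h2⟩ | ⟨h1, h2⟩
  · exact .inl ⟨by omega, e.2, by omega⟩
  · exact .inr ⟨by omega, e.2, by omega⟩

theorem sidon_offset : ∀ i j k l : Fin 5, offset i + offset k = offset j + offset l →
    i = j ∨ i = l := by
  decide +kernel

theorem not_cycle_three (n : ℕ) : HasNoCycleOfLength (graph n) 3 := by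
  intro v c _ hl
  have h0 := c.adj_getVert_succ (i := 0) (by omega)
  have h1 := c.adj_getVert_succ (i := 1) (by omega)
  have h2 := c.adj_getVert_succ (i := 2) (by omega)
  have h3 := c.getVert_length
  rw [hl] at h3
  simp only [zero_add, Nat.reduceAdd, h3, c.getVert_zero] at h0 h1 h2
  rcases adj_parity h0 with ⟨_, _, _⟩ | ⟨_, _, _⟩ <;>
  rcases adj_parity h1 with ⟨_, _, _⟩ | ⟨_, _, _⟩ <;>
  rcases adj_parity h2 with ⟨_, _, _⟩ | ⟨_, _, _⟩ <;> omega

theorem not_cycle_four (n : ℕ) : HasNoCycleOfLength (graph n) 4 := by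
  intro v c hc hl
  have h0 := c.adj_getVert_succ (i := 0) (by omega)
  have h1 := c.adj_getVert_succ (i := 1) (by omega)
  have h2 := c.adj_getVert_succ (i := 2) (by omega)
  have h3 := c.adj_getVert_succ (i := 3) (by omega)
  have h4 := c.getVert_length
  rw [hl] at h4
  have n1 : c.getVert 1 ≠ c.getVert 3 := fun h => by
    have := hc.getVert_injOn (by simp [hl]) (by simp [hl]) h
    omega
  have n2 : c.getVert 2 ≠ v := fun h => by
    have := hc.getVert_injOn (x₁ := 2) (x₂ := 4) (by simp [hl]) (by simp [hl]) (h.trans h4.symm)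
    omega
  simp only [zero_add, Nat.reduceAdd, h4, c.getVert_zero] at h0 h1 h2 h3
  rw [Ne, ← Fin.val_inj] at n1 n2
  rcases adj_parity h0 with ⟨_, i, _⟩ | ⟨_, i, _⟩ <;>
  rcases adj_parity h1 with ⟨_, j, _⟩ | ⟨_, j, _⟩ <;> try omega
  all_goals
    rcases adj_parity h2 with ⟨_, k, _⟩ | ⟨_, k, _⟩ <;> try omega
    rcases adj_parity h3 with ⟨_, l, _⟩ | ⟨_, l, _⟩ <;> try omega
    rcases sidon_offset i j k l (by omega) with rfl | rfl <;> omega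

theorem offset_injective : Function.Injective offset := by
  intro i j h
  simpa using sidon_offset i j i j (by rw [h])

theorem offset_le : ∀ i, offset i ≤ 16 := by
  decide +kernel

theorem le_ncard_edgeSet (n : ℕ) : 5 * (n / 2 - 17) ≤ (graph n).edgeSet.ncard := by
  have hlt : ∀ x : Fin (n / 2 - 17) × Fin 5, 2 * (x.1.val + offset x.2) + 1 < n := by
    intro x
    have := offset_le x.2
    have := x.1.2
    omega
  let φ : Fin (n / 2 - 17) × Fin 5 → Sym2 (Fin n) := fun x =>
    s(⟨2 * x.1, by have := hlt x; omega⟩, ⟨2 * (x.1 + offset x.2) + 1, hlt x⟩)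
  have hφ : Function.Injective φ := by
    intro x y hxy
    simp only [φ, Sym2.eq_iff, Fin.mk.injEq] at hxy
    rcases hxy with ⟨h1, h2⟩ | ⟨h1, h2⟩
    · exact Prod.ext (Fin.ext (by omega)) (offset_injective (by omega))
    · omega
  calc 5 * (n / 2 - 17) = (Set.range φ).ncard := by
        rw [← Set.image_univ, Set.ncard_image_of_injective _ hφ, Set.ncard_univ]
        simp [mul_comm]
    _ ≤ _ := by
        refine Set.ncard_le_ncard ?_ (Set.toFinite _)
        rintro _ ⟨x, rfl⟩
        exact ⟨(x.1, x.2), rfl⟩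

end SpiralDrawing

theorem stmt_19 :
    ∃ (C : ℝ) (N : ℕ), 0 ≤ C ∧ ∀ n : ℕ, N ≤ n →
      ∃ G : SimpleGraph (Fin n), HasNoCycleOfLength G 3 ∧
        HasNoCycleOfLength G 4 ∧ KPlanar G 3 ∧
        (5 / 2 : ℝ) * n - C ≤ G.edgeSet.ncard := by
  refine ⟨90, 0, by norm_num, fun n _ => ⟨SpiralDrawing.graph n, SpiralDrawing.not_cycle_three n,
    SpiralDrawing.not_cycle_four n, ⟨_, SpiralDrawing.drawing_isKPlane n⟩, ?_⟩⟩
  have h := SpiralDrawing.le_ncard_edgeSet n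
  have h' : 5 * n ≤ 2 * (SpiralDrawing.graph n).edgeSet.ncard + 180 := by omega
  have h'' : (5 : ℝ) * n ≤ 2 * (SpiralDrawing.graph n).edgeSet.ncard + 180 := by exact_mod_cast h'
  linarith
end
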